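/- arXiv:2005.05956 — 3 statements merged into one kernel-verified Lean document; each statement's English description precedes it below -/
import Mathlib

section
/- Let 𝒞 be a category and Bun : 𝒞ᵒᵖ ⥤ Cat a strict indexed category. Consider two horizontally adjacent squares in the Grothendieck double construction: lenses ⟨f₁♯,f₁⟩ : ⟨A₁,C₁⟩ ⇆ ⟨A₃,C₃⟩, ⟨f₂♯,f₂⟩ : ⟨A₂,C₂⟩ ⇆ ⟨A₄,C₄⟩, ⟨f₃♯,f₃⟩ : ⟨A₅,C₅⟩ ⇆ ⟨A₆,C₆⟩ (vertical sides), and bundle maps ⟨g₁♯,g₁⟩ : ⟨A₁,C₁⟩ ⇉ ⟨A₂,C₂⟩, ⟨g₂♯,g₂⟩ : ⟨A₃,C₃⟩ ⇉ ⟨A₄,C₄⟩, ⟨g₃♯,g₃⟩ : ⟨A₂,C₂⟩ ⇉ ⟨A₅,C₅⟩, ⟨g₄♯,g₄⟩ : ⟨A₄,C₄⟩ ⇉ ⟨A₆,C₆⟩ (horizontal sides). If the left square commutes (f₁ ≫ g₂ = g₁ ≫ f₂ and g₁♯ ∘ f₁♯ = g₁*(f₂♯) ∘ ι ∘ f₁*(g₂♯),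 where ι : f₁*(g₂*A₄) ⟶ g₁*(f₂*A₄) is the strictness identification) and the right square commutes (f₂ ≫ g₄ = g₃ ≫ f₃ and g₃♯ ∘ f₂♯ = g₃*(f₃♯) ∘ ι' ∘ f₂*(g₄♯)), then the horizontal composite square, with vertical sides ⟨f₁♯,f₁⟩ and ⟨f₃♯,f₃⟩ and horizontal sides the composite bundle maps ⟨g₁♯,g₁⟩ ≫ ⟨g₃♯,g₃⟩ and ⟨g₂♯,g₂⟩ ≫ ⟨g₄♯,g₄⟩, also commutes. -/
open CategoryTheory Opposite

universe w₁ w₂ v u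

variable {𝒞 : Type u} [Category.{v} 𝒞] (Bun : 𝒞ᵒᵖ ⥤ Cat.{w₁, w₂})

def re {C C' : 𝒞} (f : C ⟶ C') : ↥(Bun.obj (op C')) ⥤ ↥(Bun.obj (op C)) :=
  (Bun.map f.op).toFunctor

theorem re_id (C : 𝒞) : re Bun (𝟙 C) = 𝟭 (Bun.obj (op C)) := by
  simp [re]

theorem re_id_obj (C : 𝒞) (A : Bun.obj (op C)) : (re Bun (𝟙 C)).obj A = A := by
  rw [re_id]; rfl

theorem re_comp {C C' C'' : 𝒞} (f : C ⟶ C') (g : C' ⟶ C'') :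
    re Bun (f ≫ g) = re Bun g ⋙ re Bun f := by
  simp [re]

theorem re_comp_obj {C C' C'' : 𝒞} (f : C ⟶ C') (g : C' ⟶ C'')
    (A : Bun.obj (op C'')) :
    (re Bun (f ≫ g)).obj A = (re Bun f).obj ((re Bun g).obj A) := by
  rw [re_comp]; rfl

/-- The strictness identification between two iterated reindexings along the two
sides of a commuting square in the base. -/
theorem re_re_obj {C₁ C₂ C₃ C₄ : 𝒞} {a : C₁ ⟶ C₃} {b : C₃ ⟶ C₄} {c : C₁ ⟶ C₂}
    {d : C₂ ⟶ C₄} (h : a ≫ b = c ≫ d) (A : Bun.obj (op C₄)) :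
    (re Bun a).obj ((re Bun b).obj A) = (re Bun c).obj ((re Bun d).obj A) := by
  rw [← re_comp_obj, ← re_comp_obj, h]

structure LensObj where
  base : 𝒞
  fib : Bun.obj (op base)

/-- A lens `⟨f♯, f⟩ : ⟨A,C⟩ ⇆ ⟨A',C'⟩`. -/
structure Lens (X Y : LensObj Bun) where
  base : X.base ⟶ Y.base
  fib : (re Bun base).obj Y.fib ⟶ X.fib

/-- A bundle map `⟨g♯, g⟩ : ⟨A,C⟩ ⇉ ⟨A',C'⟩`. -/
structure BMap (X Y : LensObj Bun) where
  base : X.base ⟶ Y.base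
  fib : X.fib ⟶ (re Bun base).obj Y.fib

/-- Composition of bundle maps: `⟨h♯,h⟩ ∘ ⟨g♯,g⟩ = ⟨ι ∘ g*(h♯) ∘ g♯, g ≫ h⟩`. -/
def BMap.comp {X Y Z : LensObj Bun} (g : BMap Bun X Y) (h : BMap Bun Y Z) :
    BMap Bun X Z where
  base := g.base ≫ h.base
  fib := g.fib ≫ (re Bun g.base).map h.fib ≫ eqToHom (re_comp_obj Bun g.base h.base Z.fib).symm

/-- Composition of lenses: `⟨g♯,g⟩ ∘ ⟨f♯,f⟩ = ⟨f♯ ∘ f*(g♯) ∘ ι, f ≫ g⟩`. -/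
def Lens.comp {X Y Z : LensObj Bun} (f : Lens Bun X Y) (g : Lens Bun Y Z) :
    Lens Bun X Z where
  base := f.base ≫ g.base
  fib := eqToHom (re_comp_obj Bun f.base g.base Z.fib) ≫ (re Bun f.base).map g.fib ≫ f.fib

/-- A square in the Grothendieck double construction, with vertical sides the lenses
`f₁` (left) and `f₂` (right) and horizontal sides the bundle maps `g₁` (top) and
`g₂` (bottom), commutes when both the base square and the fiber square commute. -/
def SquareCommutes {X₁ X₂ X₃ X₄ : LensObj Bun} (f₁ : Lens Bun X₁ X₃)
    (f₂ : Lens Bun X₂ X₄) (g₁ : BMap Bun X₁ X₂) (g₂ : BMap Bun X₃ X₄) : Prop :=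
  ∃ hbase : f₁.base ≫ g₂.base = g₁.base ≫ f₂.base,
    f₁.fib ≫ g₁.fib =
      (re Bun f₁.base).map g₂.fib ≫ eqToHom (re_re_obj Bun hbase X₄.fib) ≫
        (re Bun g₁.base).map f₂.fib

theorem re_comp_map {C C' C'' : 𝒞} (f : C ⟶ C') (g : C' ⟶ C'')
    {A B : Bun.obj (op C'')} (k : A ⟶ B) :
    (re Bun (f ≫ g)).map k =
      eqToHom (re_comp_obj Bun f g A) ≫ (re Bun f).map ((re Bun g).map k) ≫
        eqToHom (re_comp_obj Bun f g B).symm :=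
  Functor.congr_hom (re_comp Bun f g) k

/-- Naturality of the strictness identification `re_re_obj`. -/
theorem re_re_map {C₁ C₂ C₃ C₄ : 𝒞} {a : C₁ ⟶ C₃} {b : C₃ ⟶ C₄} {c : C₁ ⟶ C₂}
    {d : C₂ ⟶ C₄} (h : a ≫ b = c ≫ d) {A B : Bun.obj (op C₄)} (k : A ⟶ B) :
    (re Bun a).map ((re Bun b).map k) ≫ eqToHom (re_re_obj Bun h B) =
      eqToHom (re_re_obj Bun h A) ≫ (re Bun c).map ((re Bun d).map k) := by
  have hfun : re Bun b ⋙ re Bun a = re Bun d ⋙ re Bun c := by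
    rw [← re_comp, ← re_comp, h]
  have hmap := Functor.congr_hom hfun k
  simp only [Functor.comp_map] at hmap
  simp [hmap]

/-!
STATEMENT 1: Horizontally adjacent commuting squares in the Grothendieck double
construction compose to a commuting square.
-/

theorem horizontal_composite_of_commuting_squares
    {X₁ X₂ X₃ X₄ X₅ X₆ : LensObj Bun}
    (f₁ : Lens Bun X₁ X₃) (f₂ : Lens Bun X₂ X₄) (f₃ : Lens Bun X₅ X₆)
    (g₁ : BMap Bun X₁ X₂) (g₂ : BMap Bun X₃ X₄)
    (g₃ : BMap Bun X₂ X₅) (g₄ : BMap Bun X₄ X₆)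
    (hleft : SquareCommutes Bun f₁ f₂ g₁ g₂)
    (hright : SquareCommutes Bun f₂ f₃ g₃ g₄) :
    SquareCommutes Bun f₁ f₃ (BMap.comp Bun g₁ g₃) (BMap.comp Bun g₂ g₄) := by
  obtain ⟨hl, el⟩ := hleft
  obtain ⟨hr, er⟩ := hright
  have hbase : f₁.base ≫ g₂.base ≫ g₄.base = (g₁.base ≫ g₃.base) ≫ f₃.base := by
    rw [← Category.assoc, hl, Category.assoc, hr, Category.assoc]
  refine ⟨hbase, ?_⟩
  have er' := congrArg (re Bun g₁.base).map er
  simp only [Functor.map_comp, eqToHom_map] at er'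
  dsimp only [BMap.comp]
  simp only [Functor.map_comp, eqToHom_map, re_comp_map, Category.assoc]
  rw [reassoc_of% el, reassoc_of% er', ← reassoc_of% re_re_map Bun hl g₄.fib]
  simp only [eqToHom_trans_assoc]
  erw [eqToHom_trans_assoc, eqToHom_trans_assoc]
end

section
/- Let 𝒞 be a category, Bun : 𝒞ᵒᵖ ⥤ Cat a strict indexed category, and ∫Bun its (contravariant) Grothendieck construction. Given composable lenses ⟨f♯,f⟩ : ⟨A,C⟩ ⇆ ⟨A',C'⟩ and ⟨g♯,g⟩ : ⟨A',C'⟩ ⇆ ⟨A'',C''⟩, the square in ∫Bun with corners ⟨f*(g*A''), C⟩ (top left), ⟨g*A'', C'⟩ (top right), ⟨f*A', C⟩ (bottom left), ⟨A', C'⟩ (bottom right), top morphism (f, id : f*(g*A'') ⟶ f*(g*A'')), bottom morphism (f, id : f*A' ⟶ f*A'), left morphism (id_C, f*(g♯) : f*(g*A'') ⟶ f*A'), and right morphism (id_{C'}, g♯ : g*A'' ⟶ A'), is a pullback square in ∫Bun. Consequently, the pullback composite of the vertical–cartesian spans associated to the two lenses is the vertical–cartesian span associated to their lens composite ⟨f♯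 ∘ f*(g♯) ∘ ι, f ≫ g⟩. -/
open CategoryTheory Opposite

universe w₁ w₂ v u

variable {𝒞 : Type u} [Category.{v} 𝒞] (Bun : 𝒞ᵒᵖ ⥤ Cat.{w₁, w₂})

/-- An object of the Grothendieck construction `∫Bun`. -/
structure Gr where
  base : 𝒞
  fib : Bun.obj (op base)

/-- A morphism `(f, φ) : ⟨A,C⟩ ⟶ ⟨A',C'⟩` in `∫Bun`. -/
structure GrHom (X Y : Gr Bun) where
  base : X.base ⟶ Y.base
  fib : X.fib ⟶ (re Bun base).obj Y.fib

theorem GrHom.ext' {X Y : Gr Bun} {f g : GrHom Bun X Y} (hb : f.base = g.base)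
    (hf : f.fib = g.fib ≫ eqToHom (by rw [hb])) : f = g := by
  cases f with
  | mk fb ff =>
    cases g with
    | mk gb gf =>
      dsimp at hb
      subst hb
      dsimp at hf
      simp only [eqToHom_refl, Category.comp_id] at hf
      subst hf
      rfl

/-- The Grothendieck construction `∫Bun` is a category. -/
instance : Category (Gr Bun) where
  Hom X Y := GrHom Bun X Y
  id X := ⟨𝟙 X.base, eqToHom (re_id_obj Bun X.base X.fib).symm⟩
  comp {X Y Z} f g :=
    ⟨f.base ≫ g.base,
      f.fib ≫ (re Bun f.base).map g.fib ≫ eqToHom (re_comp_obj Bun f.base g.base Z.fib).symm⟩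
  id_comp {X Y} f := by
    apply GrHom.ext' Bun (by simp)
    dsimp
    rw [Functor.congr_hom (re_id Bun X.base) f.fib]
    simp
  comp_id {X Y} f := by
    apply GrHom.ext' Bun (by simp)
    dsimp
    simp [eqToHom_map]
  assoc {W X Y Z} f g h := by
    apply GrHom.ext' Bun (by simp)
    dsimp
    rw [Functor.congr_hom (re_comp Bun f.base g.base) h.fib]
    simp [eqToHom_map]

/-- The vertical leg `(𝟙 C, f♯) : ⟨f*A', C⟩ ⟶ ⟨A, C⟩` of the span associated to a
lens `⟨f♯, f⟩ : ⟨A,C⟩ ⇆ ⟨A',C'⟩`. -/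
def vertLeg {C C' : 𝒞} (f : C ⟶ C') {A : Bun.obj (op C)} {A' : Bun.obj (op C')}
    (fs : (re Bun f).obj A' ⟶ A) :
    Gr.mk C ((re Bun f).obj A') ⟶ Gr.mk C A :=
  GrHom.mk (𝟙 C) (fs ≫ eqToHom (re_id_obj Bun C A).symm)

/-- The cartesian leg `(f, 𝟙) : ⟨f*A', C⟩ ⟶ ⟨A', C'⟩` of the span associated to a
lens along `f`. -/
def cartLeg {C C' : 𝒞} (f : C ⟶ C') (A' : Bun.obj (op C')) :
    Gr.mk C ((re Bun f).obj A') ⟶ Gr.mk C' A' :=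
  GrHom.mk f (𝟙 ((re Bun f).obj A'))

/-!
STATEMENT 3: The square with corners `⟨f*(g*A''), C⟩`, `⟨g*A'', C'⟩`, `⟨f*A', C⟩`,
`⟨A', C'⟩`, top and bottom `(f, id)`, left `(𝟙_C, f*(g♯))`, right `(𝟙_{C'}, g♯)`,
is a pullback square in `∫Bun`; consequently the pullback composite of the
vertical–cartesian spans of two lenses is the vertical–cartesian span of their
composite lens.
-/

theorem Gr.hom_ext {X Y : Gr Bun} {a b : X ⟶ Y} (hb : GrHom.base a = GrHom.base b)
    (hf : GrHom.fib a = GrHom.fib b ≫ eqToHom (by rw [hb])) : a = b :=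
  GrHom.ext' Bun hb hf

theorem Gr.comp_base {X Y Z : Gr Bun} (a : X ⟶ Y) (b : Y ⟶ Z) :
    GrHom.base (a ≫ b) = GrHom.base a ≫ GrHom.base b := rfl

theorem Gr.comp_fib {X Y Z : Gr Bun} (a : X ⟶ Y) (b : Y ⟶ Z) :
    GrHom.fib (a ≫ b) = GrHom.fib a ≫ (re Bun (GrHom.base a)).map (GrHom.fib b) ≫
      eqToHom (re_comp_obj Bun (GrHom.base a) (GrHom.base b) Z.fib).symm := rfl

theorem GrHom.fib_congr {X Y : Gr Bun} {a b : X ⟶ Y} (h : a = b) :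
    GrHom.fib a = GrHom.fib b ≫ eqToHom (by rw [h]) := by
  subst h
  simp

theorem Gr.eqToHom_mk_comp {C : 𝒞} {A B : Bun.obj (op C)} (h : A = B) {Y : Gr Bun}
    (a : Gr.mk C B ⟶ Y) :
    eqToHom (congrArg (Gr.mk C) h) ≫ a =
      GrHom.mk (X := Gr.mk C A) (Y := Y) (GrHom.base (X := Gr.mk C B) a)
        ((eqToHom h : A ⟶ B) ≫ GrHom.fib (X := Gr.mk C B) a) := by
  subst h
  simp only [eqToHom_refl, Category.id_comp]
  rfl

/-- Morphisms into the source of a cartesian leg are determined by their base and their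
composite with the leg. -/
theorem cartLeg_hom_ext {C C' : 𝒞} (f : C ⟶ C') (A' : Bun.obj (op C')) {W : Gr Bun}
    {u v : W ⟶ Gr.mk C ((re Bun f).obj A')} (hb : GrHom.base u = GrHom.base v)
    (h : u ≫ cartLeg Bun f A' = v ≫ cartLeg Bun f A') : u = v := by
  refine Gr.hom_ext Bun hb ?_
  have hf := GrHom.fib_congr Bun h
  rw [← cancel_mono (eqToHom (re_comp_obj Bun (GrHom.base u) f A').symm)]
  simp only [Gr.comp_fib, cartLeg] at hf
  simp at hf ⊢
  exact hf.trans (congrArg (GrHom.fib v ≫ ·) (eqToHom_trans _ _))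

/-- The factorization through a cartesian leg of a morphism whose base factors through `f`. -/
def cartLift {C C' : 𝒞} (f : C ⟶ C') (A' : Bun.obj (op C')) {W : Gr Bun}
    (a : W ⟶ Gr.mk C' A') (k : W.base ⟶ C) (h : GrHom.base a = k ≫ f) :
    W ⟶ Gr.mk C ((re Bun f).obj A') :=
  GrHom.mk k (GrHom.fib a ≫ eqToHom (by rw [h, re_comp_obj]))

theorem cartLift_comp_cartLeg {C C' : 𝒞} (f : C ⟶ C') (A' : Bun.obj (op C')) {W : Gr Bun}
    (a : W ⟶ Gr.mk C' A') (k : W.base ⟶ C) (h : GrHom.base a = k ≫ f) :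
    cartLift Bun f A' a k h ≫ cartLeg Bun f A' = a := by
  refine Gr.hom_ext Bun h.symm ?_
  simp [Gr.comp_fib, cartLeg, cartLift]

/-- Reindexing a vertical morphism along `f` commutes with the cartesian legs. -/
theorem cartLeg_comp_vertical {C C' : 𝒞} (f : C ⟶ C') {A B : Bun.obj (op C')} (p : B ⟶ A) :
    cartLeg Bun f B ≫ GrHom.mk (X := Gr.mk C' B) (Y := Gr.mk C' A) (𝟙 C')
        (p ≫ eqToHom (re_id_obj Bun C' A).symm) =
      GrHom.mk (X := Gr.mk C ((re Bun f).obj B)) (Y := Gr.mk C ((re Bun f).obj A)) (𝟙 C)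
        ((re Bun f).map p ≫ eqToHom (re_id_obj Bun C ((re Bun f).obj A)).symm) ≫
        cartLeg Bun f A := by
  refine Gr.hom_ext Bun ((Category.comp_id f).trans (Category.id_comp f).symm) ?_
  simp [Gr.comp_fib, cartLeg, eqToHom_map]
  exact congrArg ((re Bun f).map p ≫ ·) (eqToHom_trans _ _).symm

/-- Reindexing a vertical morphism along `f` gives a pullback square of cartesian legs. -/
theorem isPullback_cartLeg {C C' : 𝒞} (f : C ⟶ C') {A B : Bun.obj (op C')} (p : B ⟶ A) :
    IsPullback (cartLeg Bun f B)
      (GrHom.mk (X := Gr.mk C ((re Bun f).obj B)) (Y := Gr.mk C ((re Bun f).obj A)) (𝟙 C)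
        ((re Bun f).map p ≫ eqToHom (re_id_obj Bun C ((re Bun f).obj A)).symm))
      (GrHom.mk (X := Gr.mk C' B) (Y := Gr.mk C' A) (𝟙 C')
        (p ≫ eqToHom (re_id_obj Bun C' A).symm))
      (cartLeg Bun f A) := by
  have base_eq : ∀ {W : Gr Bun} (a : W ⟶ Gr.mk C' B) (b : W ⟶ Gr.mk C ((re Bun f).obj A)),
      a ≫ GrHom.mk (X := Gr.mk C' B) (Y := Gr.mk C' A) (𝟙 C')
        (p ≫ eqToHom (re_id_obj Bun C' A).symm) = b ≫ cartLeg Bun f A →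
      GrHom.base a = GrHom.base b ≫ f := fun a b h =>
    (Category.comp_id (GrHom.base a)).symm.trans (congrArg GrHom.base h)
  refine ⟨⟨cartLeg_comp_vertical Bun f p⟩, ⟨Limits.PullbackCone.IsLimit.mk _
    (fun s => cartLift Bun f B s.fst (GrHom.base s.snd) (base_eq _ _ s.condition))
    (fun s => cartLift_comp_cartLeg Bun f B _ _ _) (fun s => ?_) (fun s m h₁ h₂ => ?_)⟩⟩
  · refine cartLeg_hom_ext Bun f A (Category.comp_id _) ?_
    rw [Category.assoc, ← cartLeg_comp_vertical, ← Category.assoc, cartLift_comp_cartLeg,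
      s.condition]
  · refine cartLeg_hom_ext Bun f B ?_ (h₁.trans (cartLift_comp_cartLeg Bun f B _ _ _).symm)
    exact (Category.comp_id (GrHom.base m)).symm.trans (congrArg GrHom.base h₂)

theorem lens_spans_compose_by_pullback
    {C C' C'' : 𝒞} (f : C ⟶ C') (g : C' ⟶ C'')
    {A : Bun.obj (op C)} {A' : Bun.obj (op C')} {A'' : Bun.obj (op C'')}
    (fs : (re Bun f).obj A' ⟶ A) (gs : (re Bun g).obj A'' ⟶ A') :
    IsPullback
      -- top: `(f, id) : ⟨f*(g*A''), C⟩ ⟶ ⟨g*A'', C'⟩`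
      (GrHom.mk (X := Gr.mk C ((re Bun f).obj ((re Bun g).obj A'')))
        (Y := Gr.mk C' ((re Bun g).obj A'')) f (𝟙 _))
      -- left: `(𝟙_C, f*(g♯)) : ⟨f*(g*A''), C⟩ ⟶ ⟨f*A', C⟩`
      (GrHom.mk (X := Gr.mk C ((re Bun f).obj ((re Bun g).obj A'')))
        (Y := Gr.mk C ((re Bun f).obj A')) (𝟙 C)
        ((re Bun f).map gs ≫ eqToHom (re_id_obj Bun C ((re Bun f).obj A')).symm))
      -- right: `(𝟙_{C'}, g♯) : ⟨g*A'', C'⟩ ⟶ ⟨A', C'⟩`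
      (vertLeg Bun g gs)
      -- bottom: `(f, id) : ⟨f*A', C⟩ ⟶ ⟨A', C'⟩`
      (cartLeg Bun f A') ∧
    -- Consequently, composing the two spans by this pullback yields the span of the
    -- composite lens `⟨f♯ ∘ f*(g♯) ∘ ι, f ≫ g⟩` (up to the strictness identification).
    (eqToHom (show Gr.mk C ((re Bun (f ≫ g)).obj A'') =
          Gr.mk C ((re Bun f).obj ((re Bun g).obj A'')) by rw [re_comp_obj]) ≫
        GrHom.mk (Y := Gr.mk C ((re Bun f).obj A')) (𝟙 C)
          ((re Bun f).map gs ≫ eqToHom (re_id_obj Bun C ((re Bun f).obj A')).symm) ≫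
        vertLeg Bun f fs =
      vertLeg Bun (f ≫ g)
        (eqToHom (re_comp_obj Bun f g A'') ≫ (re Bun f).map gs ≫ fs)) ∧
    (eqToHom (show Gr.mk C ((re Bun (f ≫ g)).obj A'') =
          Gr.mk C ((re Bun f).obj ((re Bun g).obj A'')) by rw [re_comp_obj]) ≫
        GrHom.mk (Y := Gr.mk C' ((re Bun g).obj A'')) f (𝟙 _) ≫
        cartLeg Bun g A'' =
      cartLeg Bun (f ≫ g) A'') := by
  refine ⟨isPullback_cartLeg Bun f gs, ?_, ?_⟩
  · rw [Gr.eqToHom_mk_comp Bun (re_comp_obj Bun f g A'')]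
    refine Gr.hom_ext Bun (Category.comp_id (𝟙 C)) ?_
    simp only [Gr.comp_fib, vertLeg, Functor.congr_hom (re_id Bun C)]
    simp
    exact congrArg (eqToHom _ ≫ (re Bun f).map gs ≫ fs ≫ ·) (eqToHom_trans _ _).symm
  · rw [Gr.eqToHom_mk_comp Bun (re_comp_obj Bun f g A'')]
    refine Gr.hom_ext Bun rfl ?_
    simp [Gr.comp_fib, cartLeg]
    rfl
end

section
/- Let 𝒞 be a category, Bun : 𝒞ᵒᵖ ⥤ Cat a strict indexed category, and ∫Bun its Grothendieck construction. Let ⟨A,C⟩ ⟵ ⟨B,D⟩ ⟶ ⟨A',C'⟩ be a span in ∫Bun whose left leg is vertical (its base component is an identity, so D = C and the leg is (id_C, v : B ⟶ A)) and whose right leg is cartesian (it is (f, ψ) with ψ : B ⟶ f*A' an isomorphism). Then there is a unique lens ⟨f♯, f⟩ : ⟨A,C⟩ ⇆ ⟨A',C'⟩, namely f♯ = v ∘ ψ⁻¹ : f*A' ⟶ A, whose associated vertical–cartesian span (with apex ⟨f*A',C⟩, left leg (id_C, f♯), right leg (f, id)) is isomorphic to the given span via an isomorphism of spans in ∫Bun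 that commutes with both legs; moreover this isomorphism of spans is unique. -/
open CategoryTheory Opposite

universe w₁ w₂ v u

variable {𝒞 : Type u} [Category.{v} 𝒞] (Bun : 𝒞ᵒᵖ ⥤ Cat.{w₁, w₂})

/-!
STATEMENT 5: Given a span `⟨A,C⟩ ⟵ ⟨B,C⟩ ⟶ ⟨A',C'⟩` in `∫Bun` whose left leg is
vertical, `(𝟙_C, v : B ⟶ A)`, and whose right leg `(f, ψ)` is cartesian (`ψ` an
isomorphism), there is a unique lens `⟨f♯, f⟩ : ⟨A,C⟩ ⇆ ⟨A',C'⟩` — namely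
`f♯ = v ∘ ψ⁻¹` — whose associated vertical–cartesian span is isomorphic to the
given span via an isomorphism of spans commuting with both legs, and this
isomorphism of spans is unique.
-/

/-- The vertical morphism `(𝟙 C, g) : ⟨A, C⟩ ⟶ ⟨A', C⟩` of `∫Bun` given by a morphism `g` in the
fibre over `C`. -/
def vertHom {C : 𝒞} {A A' : Bun.obj (op C)} (g : A ⟶ A') : Gr.mk C A ⟶ Gr.mk C A' :=
  GrHom.mk (𝟙 C) (g ≫ eqToHom (re_id_obj Bun C A').symm)

theorem vertHom_id {C : 𝒞} (A : Bun.obj (op C)) : vertHom Bun (𝟙 A) = 𝟙 (Gr.mk C A) :=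
  congrArg (GrHom.mk (X := Gr.mk C A) (Y := Gr.mk C A) (𝟙 C)) (Category.id_comp _)

theorem vertHom_comp_mk {C C' : 𝒞} (f : C ⟶ C') {A B : Bun.obj (op C)} {A' : Bun.obj (op C')}
    (g : B ⟶ A) (φ : A ⟶ (re Bun f).obj A') :
    vertHom Bun g ≫ (GrHom.mk f φ : Gr.mk C A ⟶ Gr.mk C' A') =
      (GrHom.mk f (g ≫ φ) : Gr.mk C B ⟶ Gr.mk C' A') := by
  apply GrHom.ext' Bun (Category.id_comp f)
  change (g ≫ eqToHom _) ≫ (re Bun (𝟙 C)).map φ ≫ eqToHom _ = (g ≫ φ) ≫ eqToHom _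
  rw [Functor.congr_hom (re_id Bun C) φ]
  simp only [Functor.id_map, Category.assoc, eqToHom_trans_assoc, eqToHom_refl, Category.id_comp]
  erw [eqToHom_trans]

theorem vertHom_comp_vertHom {C : 𝒞} {A A' A'' : Bun.obj (op C)} (g : A ⟶ A') (h : A' ⟶ A'') :
    vertHom Bun g ≫ vertHom Bun h = vertHom Bun (g ≫ h) := by
  refine (vertHom_comp_mk Bun (𝟙 C) g _).trans ?_
  rw [← Category.assoc]
  rfl

theorem GrHom.mk_injective {X Y : Gr Bun} (f : X.base ⟶ Y.base) :
    Function.Injective (GrHom.mk (Bun := Bun) (X := X) (Y := Y) f) := by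
  intro φ φ' h
  cases h
  rfl

theorem vertHom_injective {C : 𝒞} {A A' : Bun.obj (op C)} :
    Function.Injective (vertHom Bun : (A ⟶ A') → (Gr.mk C A ⟶ Gr.mk C A')) := by
  intro g g' h
  exact (cancel_mono (eqToHom (re_id_obj Bun C A').symm)).1
    (GrHom.mk_injective Bun (X := Gr.mk C A) (Y := Gr.mk C A') (𝟙 C) h)

theorem exists_eq_vertHom {C : 𝒞} {A A' : Bun.obj (op C)} (m : Gr.mk C A ⟶ Gr.mk C A')
    (hm : GrHom.base m = 𝟙 C) : ∃ g : A ⟶ A', m = vertHom Bun g := by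
  obtain ⟨b, φ⟩ := m
  dsimp at hm
  subst hm
  refine ⟨φ ≫ eqToHom (re_id_obj Bun C A'),
    congrArg (GrHom.mk (X := Gr.mk C A) (Y := Gr.mk C A') (𝟙 C)) ?_⟩
  simp

/-- The isomorphism of `∫Bun` given by an isomorphism in the fibre over `C`. -/
def vertIso {C : 𝒞} {A A' : Bun.obj (op C)} (g : A ≅ A') : Gr.mk C A ≅ Gr.mk C A' where
  hom := vertHom Bun g.hom
  inv := vertHom Bun g.inv
  hom_inv_id := by rw [vertHom_comp_vertHom, g.hom_inv_id, vertHom_id]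
  inv_hom_id := by rw [vertHom_comp_vertHom, g.inv_hom_id, vertHom_id]

theorem vertHom_comp_cartLeg {C C' : 𝒞} (f : C ⟶ C') {B : Bun.obj (op C)} {A' : Bun.obj (op C')}
    (ψ : B ⟶ (re Bun f).obj A') :
    vertHom Bun ψ ≫ cartLeg Bun f A' = (GrHom.mk f ψ : Gr.mk C B ⟶ Gr.mk C' A') := by
  refine (vertHom_comp_mk Bun f ψ _).trans ?_
  rw [Category.comp_id]

/-- A map from `⟨B, C⟩` to the apex of the span of a lens is a map of spans exactly when it is
`(𝟙 C, ψ)` and the lens composes with `ψ` to the given vertical leg. -/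
theorem comp_legs_eq_iff {C C' : 𝒞} (f : C ⟶ C') {A B : Bun.obj (op C)} {A' : Bun.obj (op C')}
    (v : B ⟶ A) (ψ : B ⟶ (re Bun f).obj A') (fs : (re Bun f).obj A' ⟶ A)
    (m : Gr.mk C B ⟶ Gr.mk C ((re Bun f).obj A')) :
    (m ≫ vertLeg Bun f fs = vertHom Bun v ∧
      m ≫ cartLeg Bun f A' = (GrHom.mk f ψ : Gr.mk C B ⟶ Gr.mk C' A')) ↔
      m = vertHom Bun ψ ∧ ψ ≫ fs = v := by
  constructor
  · rintro ⟨hv, hc⟩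
    obtain ⟨g, rfl⟩ := exists_eq_vertHom Bun m
      ((Category.comp_id (GrHom.base m)).symm.trans (congrArg GrHom.base hv))
    rw [vertHom_comp_cartLeg] at hc
    obtain rfl := GrHom.mk_injective Bun (X := Gr.mk C B) (Y := Gr.mk C' A') f hc
    exact ⟨rfl, vertHom_injective Bun ((vertHom_comp_vertHom Bun g fs).symm.trans hv)⟩
  · rintro ⟨rfl, rfl⟩
    exact ⟨vertHom_comp_vertHom Bun ψ fs, vertHom_comp_cartLeg Bun f ψ⟩

theorem unique_lens_of_vertical_cartesian_span
    {C C' : 𝒞} (f : C ⟶ C') {A B : Bun.obj (op C)} {A' : Bun.obj (op C')}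
    (v : B ⟶ A) (ψ : B ⟶ (re Bun f).obj A') [IsIso ψ] :
    (∃! fs : (re Bun f).obj A' ⟶ A,
      ∃! e : Gr.mk C B ≅ Gr.mk C ((re Bun f).obj A'),
        e.hom ≫ vertLeg Bun f fs =
            GrHom.mk (𝟙 C) (v ≫ eqToHom (re_id_obj Bun C A).symm) ∧
          e.hom ≫ cartLeg Bun f A' = GrHom.mk f ψ) ∧
    (∀ fs : (re Bun f).obj A' ⟶ A,
      (∃ e : Gr.mk C B ≅ Gr.mk C ((re Bun f).obj A'),
        e.hom ≫ vertLeg Bun f fs =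
            GrHom.mk (𝟙 C) (v ≫ eqToHom (re_id_obj Bun C A).symm) ∧
          e.hom ≫ cartLeg Bun f A' = GrHom.mk f ψ) →
        fs = inv ψ ≫ v) := by
  have key : ∀ (fs : (re Bun f).obj A' ⟶ A) (e : Gr.mk C B ≅ Gr.mk C ((re Bun f).obj A')),
      e.hom ≫ vertLeg Bun f fs = GrHom.mk (𝟙 C) (v ≫ eqToHom (re_id_obj Bun C A).symm) ∧
        e.hom ≫ cartLeg Bun f A' = GrHom.mk f ψ ↔ e.hom = vertHom Bun ψ ∧ ψ ≫ fs = v :=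
    fun fs e => comp_legs_eq_iff Bun f v ψ fs e.hom
  simp only [key]
  refine ⟨⟨inv ψ ≫ v, ⟨vertIso Bun (asIso ψ), ⟨rfl, by simp⟩, fun e he => Iso.ext he.1⟩, ?_⟩, ?_⟩
  · rintro fs ⟨e, ⟨-, h⟩, -⟩
    exact (IsIso.eq_inv_comp ψ).2 h
  · rintro fs ⟨e, -, h⟩
    exact (IsIso.eq_inv_comp ψ).2 h
end
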